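/- (Feasibility of the Gauss-Newton step.) Suppose K ∈ 𝕂 and define the update K'_i = K_i − 2η(R_i + B_iᵀ E_i(P^K) B_i)^{−1} L^K_i for i = 1,…,N. If the step size satisfies 0 < η ≤ 1/2, then K' ∈ 𝕂, i.e., K' is mean-square stabilizing. -/

import Mathlib

open Matrix Filter
open scoped Kronecker Topology

namespace MJLS

noncomputable section

attribute [local instance] Classical.propDecidable

/-- Closed-loop matrices `Γ i = A i - B i * K i`. -/
def Gam {d k N : ℕ} (A : Fin N → Matrix (Fin d) (Fin d) ℝ)
    (B : Fin N → Matrix (Fin d) (Fin k) ℝ)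
    (K : Fin N → Matrix (Fin k) (Fin d) ℝ) : Fin N → Matrix (Fin d) (Fin d) ℝ :=
  fun i => A i - B i * K i

/-- The operator `E_i(V) = ∑ j, p i j • V j`. -/
def opE {d N : ℕ} (Pr : Matrix (Fin N) (Fin N) ℝ)
    (V : Fin N → Matrix (Fin d) (Fin d) ℝ) : Fin N → Matrix (Fin d) (Fin d) ℝ :=
  fun i => ∑ j, Pr i j • V j

/-- The matrix `𝒜 = diag(Γᵀ ⊗ Γᵀ) (P ⊗ I)`. -/
def calA {d N : ℕ} (Pr : Matrix (Fin N) (Fin N) ℝ)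
    (Γ : Fin N → Matrix (Fin d) (Fin d) ℝ) :
    Matrix (Fin N × Fin d × Fin d) (Fin N × Fin d × Fin d) ℝ :=
  (Matrix.reindex (Equiv.prodComm (Fin d × Fin d) (Fin N))
      (Equiv.prodComm (Fin d × Fin d) (Fin N))
      (Matrix.blockDiagonal fun i => (Γ i)ᵀ ⊗ₖ (Γ i)ᵀ)) *
    (Pr ⊗ₖ (1 : Matrix (Fin d × Fin d) (Fin d × Fin d) ℝ))

/-- `K` is mean-square stabilizing: the spectral radius of `𝒜` is less than `1`. -/
def MSS {d k N : ℕ} (Pr : Matrix (Fin N) (Fin N) ℝ)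
    (A : Fin N → Matrix (Fin d) (Fin d) ℝ) (B : Fin N → Matrix (Fin d) (Fin k) ℝ)
    (K : Fin N → Matrix (Fin k) (Fin d) ℝ) : Prop :=
  spectralRadius ℂ ((calA Pr (Gam A B K)).map (algebraMap ℝ ℂ)) < 1

/-- `P` solves the coupled Lyapunov equations for the policy `K`. -/
def IsLyap {d k N : ℕ} (Pr : Matrix (Fin N) (Fin N) ℝ)
    (A : Fin N → Matrix (Fin d) (Fin d) ℝ) (B : Fin N → Matrix (Fin d) (Fin k) ℝ)
    (Q : Fin N → Matrix (Fin d) (Fin d) ℝ) (R : Fin N → Matrix (Fin k) (Fin k) ℝ)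
    (K : Fin N → Matrix (Fin k) (Fin d) ℝ)
    (P : Fin N → Matrix (Fin d) (Fin d) ℝ) : Prop :=
  ∀ i, P i = Q i + (K i)ᵀ * R i * K i + (Gam A B K i)ᵀ * opE Pr P i * Gam A B K i

/-- `P^K`, the (for mean-square stabilizing `K`, unique) solution of the coupled
Lyapunov equations. -/
def PK {d k N : ℕ} (Pr : Matrix (Fin N) (Fin N) ℝ)
    (A : Fin N → Matrix (Fin d) (Fin d) ℝ) (B : Fin N → Matrix (Fin d) (Fin k) ℝ)
    (Q : Fin N → Matrix (Fin d) (Fin d) ℝ) (R : Fin N → Matrix (Fin k) (Fin k) ℝ)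
    (K : Fin N → Matrix (Fin k) (Fin d) ℝ) : Fin N → Matrix (Fin d) (Fin d) ℝ :=
  if h : ∃ P, IsLyap Pr A B Q R K P then h.choose else 0

/-- The LQR cost `C(K) = ∑ i, π i * tr(P^K_i Sg)`. -/
def cost {d k N : ℕ} (Pr : Matrix (Fin N) (Fin N) ℝ)
    (A : Fin N → Matrix (Fin d) (Fin d) ℝ) (B : Fin N → Matrix (Fin d) (Fin k) ℝ)
    (Q : Fin N → Matrix (Fin d) (Fin d) ℝ) (R : Fin N → Matrix (Fin k) (Fin k) ℝ)
    (piv : Fin N → ℝ) (Sg : Matrix (Fin d) (Fin d) ℝ)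
    (K : Fin N → Matrix (Fin k) (Fin d) ℝ) : ℝ :=
  ∑ i, piv i * (PK Pr A B Q R K i * Sg).trace

/-- The operator `T_j(V) = ∑ i, p i j • (Γ i * V i * Γ iᵀ)`. -/
def opT {d N : ℕ} (Pr : Matrix (Fin N) (Fin N) ℝ)
    (Γ : Fin N → Matrix (Fin d) (Fin d) ℝ)
    (V : Fin N → Matrix (Fin d) (Fin d) ℝ) : Fin N → Matrix (Fin d) (Fin d) ℝ :=
  fun j => ∑ i, Pr i j • (Γ i * V i * (Γ i)ᵀ)

/-- `𝐗^K = ∑_{t=0}^∞ T^t(X(0))` with `X_i(0) = π i • Sg`. -/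
def XK {d N : ℕ} (Pr : Matrix (Fin N) (Fin N) ℝ) (piv : Fin N → ℝ)
    (Sg : Matrix (Fin d) (Fin d) ℝ) (Γ : Fin N → Matrix (Fin d) (Fin d) ℝ) :
    Fin N → Matrix (Fin d) (Fin d) ℝ :=
  ∑' t : ℕ, (opT Pr Γ)^[t] (fun i => piv i • Sg)

/-- `L^K_i = (R i + B iᵀ E_i(P^K) B i) K i - B iᵀ E_i(P^K) A i`. -/
def LK {d k N : ℕ} (Pr : Matrix (Fin N) (Fin N) ℝ)
    (A : Fin N → Matrix (Fin d) (Fin d) ℝ) (B : Fin N → Matrix (Fin d) (Fin k) ℝ)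
    (Q : Fin N → Matrix (Fin d) (Fin d) ℝ) (R : Fin N → Matrix (Fin k) (Fin k) ℝ)
    (K : Fin N → Matrix (Fin k) (Fin d) ℝ) : Fin N → Matrix (Fin k) (Fin d) ℝ :=
  fun i => (R i + (B i)ᵀ * opE Pr (PK Pr A B Q R K) i * B i) * K i
    - (B i)ᵀ * opE Pr (PK Pr A B Q R K) i * A i

/-- The operator `L_i(V) = Γ iᵀ E_i(V) Γ i`. -/
def opL {d N : ℕ} (Pr : Matrix (Fin N) (Fin N) ℝ)
    (Γ : Fin N → Matrix (Fin d) (Fin d) ℝ)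
    (V : Fin N → Matrix (Fin d) (Fin d) ℝ) : Fin N → Matrix (Fin d) (Fin d) ℝ :=
  fun i => (Γ i)ᵀ * opE Pr V i * Γ i

/-- `(P^K)'[E] = ∑_{t=0}^∞ L^t(Eᵀ L^K + (L^K)ᵀ E)`. -/
def PKd {d k N : ℕ} (Pr : Matrix (Fin N) (Fin N) ℝ)
    (Γ : Fin N → Matrix (Fin d) (Fin d) ℝ)
    (Lk E : Fin N → Matrix (Fin k) (Fin d) ℝ) : Fin N → Matrix (Fin d) (Fin d) ℝ :=
  ∑' t : ℕ, (opL Pr Γ)^[t] (fun i => (E i)ᵀ * Lk i + (Lk i)ᵀ * E i)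

/-- `‖V‖₂² = ∑ i, tr(V iᵀ V i)`. -/
def norm2sq {a b N : ℕ} (V : Fin N → Matrix (Fin a) (Fin b) ℝ) : ℝ :=
  ∑ i, ((V i)ᵀ * V i).trace

/-- The inner product `⟨V, S⟩ = ∑ i, tr(V iᵀ S i)`. -/
def ip {a b N : ℕ} (V S : Fin N → Matrix (Fin a) (Fin b) ℝ) : ℝ :=
  ∑ i, ((V i)ᵀ * S i).trace

/-- The spectral norm (maximal singular value) of a matrix. -/
def specNorm {a b : ℕ} (M : Matrix (Fin a) (Fin b) ℝ) : ℝ :=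
  ⨆ x : {x : EuclideanSpace ℝ (Fin b) // ‖x‖ ≤ 1}, ‖Matrix.toEuclideanLin M x.1‖

/-- The minimal singular value of a square matrix. -/
def sigmaMin {a : ℕ} (M : Matrix (Fin a) (Fin a) ℝ) : ℝ :=
  ⨅ x : {x : EuclideanSpace ℝ (Fin a) // ‖x‖ = 1}, ‖Matrix.toEuclideanLin M x.1‖

/-- `‖V‖_max = max_i ‖V i‖` (spectral norms). -/
def maxNorm {a b N : ℕ} (V : Fin N → Matrix (Fin a) (Fin b) ℝ) : ℝ :=
  ⨆ i, specNorm (V i)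

/-- `Λ_min(V) = min_i σ_min(V i)`. -/
def lamMin {a N : ℕ} (V : Fin N → Matrix (Fin a) (Fin a) ℝ) : ℝ :=
  ⨅ i, sigmaMin (V i)

/-- `μ = (min_i π i) · σ_min(Sg)`. -/
def mu {d N : ℕ} (piv : Fin N → ℝ) (Sg : Matrix (Fin d) (Fin d) ℝ) : ℝ :=
  (⨅ i, piv i) * sigmaMin Sg

/-- `ξ(α) = (1/Λ_min(Q))·((1 + ‖B‖²_max)·α/μ + ‖R‖_max) − 1`. -/
def xi {d k N : ℕ} (B : Fin N → Matrix (Fin d) (Fin k) ℝ)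
    (R : Fin N → Matrix (Fin k) (Fin k) ℝ) (Q : Fin N → Matrix (Fin d) (Fin d) ℝ)
    (piv : Fin N → ℝ) (Sg : Matrix (Fin d) (Fin d) ℝ) (α : ℝ) : ℝ :=
  (1 / lamMin Q) * ((1 + maxNorm B ^ 2) * α / mu piv Sg + maxNorm R) - 1

/-- The smoothness constant
`L(α) = 2·(‖R‖_max + ‖B‖²_max·(1 + 2ξ(α)/‖B‖_max)·α/μ)·α/Λ_min(Q)`. -/
def Lsm {d k N : ℕ} (B : Fin N → Matrix (Fin d) (Fin k) ℝ)
    (R : Fin N → Matrix (Fin k) (Fin k) ℝ) (Q : Fin N → Matrix (Fin d) (Fin d) ℝ)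
    (piv : Fin N → ℝ) (Sg : Matrix (Fin d) (Fin d) ℝ) (α : ℝ) : ℝ :=
  2 * (maxNorm R + maxNorm B ^ 2 * (1 + 2 * xi B R Q piv Sg α / maxNorm B)
      * α / mu piv Sg) * α / lamMin Q

end

lemma calA_apply {d N : ℕ} (Pr : Matrix (Fin N) (Fin N) ℝ)
    (Γ : Fin N → Matrix (Fin d) (Fin d) ℝ) (i j : Fin N) (a b c e : Fin d) :
    calA Pr Γ (i, a, b) (j, c, e) = Pr i j * Γ i c a * Γ i e b := by
  classical
  unfold calA
  rw [Matrix.mul_apply, Finset.sum_eq_single (i, c, e)]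
  · simp [Matrix.blockDiagonal_apply]
    ring
  · rintro ⟨i', c', e'⟩ - hne
    simp only [Matrix.reindex_apply, Matrix.submatrix_apply, Equiv.prodComm_symm,
      Equiv.prodComm_apply, Prod.swap_prod_mk, Matrix.blockDiagonal_apply,
      Matrix.kroneckerMap_apply, Matrix.one_apply]
    by_cases h1 : i = i'
    · by_cases h2 : (c', e') = (c, e)
      · exact absurd (by rw [h1, h2]) hne
      · rw [if_neg h2]; simp
    · rw [if_neg h1]; simp
  · simp

lemma calA_mulVec {S : Type*} [CommRing S] (f : ℝ →+* S) {d N : ℕ}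
    (Pr : Matrix (Fin N) (Fin N) ℝ)
    (Γ : Fin N → Matrix (Fin d) (Fin d) ℝ) (v : Fin N × Fin d × Fin d → S)
    (i : Fin N) (a b : Fin d) :
    ((calA Pr Γ).map f *ᵥ v) (i, a, b) =
      (((Γ i).map f)ᵀ * (∑ j, f (Pr i j) • Matrix.of fun c e => v (j, c, e)) *
        (Γ i).map f) a b := by
  simp only [Matrix.mulVec, dotProduct, Fintype.sum_prod_type, Matrix.map_apply, calA_apply,
    Matrix.mul_apply, Matrix.sum_apply, Matrix.smul_apply, Matrix.of_apply, Matrix.transpose_apply,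
    Finset.sum_mul, Finset.mul_sum, map_mul, smul_eq_mul]
  rw [Finset.sum_comm]
  rw [Finset.sum_congr rfl fun c _ => Finset.sum_comm]
  rw [Finset.sum_comm]
  refine Finset.sum_congr rfl fun e _ => ?_
  rw [Finset.sum_comm]
  exact Finset.sum_congr rfl fun c _ => Finset.sum_congr rfl fun j _ => by ring

lemma posDef_norm_bound {d : ℕ} (Q : Matrix (Fin d) (Fin d) ℝ) (hQ : Q.PosDef) :
    ∃ c : ℝ, 0 < c ∧ ∀ x : Fin d → ℝ, ‖x‖ ^ 2 ≤ c * (x ⬝ᵥ Q *ᵥ x) := by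
  have hcont : Continuous fun x : Fin d → ℝ => x ⬝ᵥ Q *ᵥ x := by fun_prop
  rcases (Metric.sphere (0 : Fin d → ℝ) 1).eq_empty_or_nonempty with h | h
  · refine ⟨1, one_pos, fun x => ?_⟩
    have hx : x = 0 := by
      by_contra hx
      have : (‖x‖⁻¹ • x) ∈ Metric.sphere (0 : Fin d → ℝ) 1 := by
        simp [norm_smul, norm_ne_zero_iff.mpr hx]
      simp [h] at this
    simp [hx]
  · obtain ⟨z, hz, hmin⟩ := (isCompact_sphere (0 : Fin d → ℝ) 1).exists_isMinOn h
      hcont.continuousOn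
    have hz0 : z ≠ 0 := by
      rintro rfl
      simp at hz
    have hm : 0 < z ⬝ᵥ Q *ᵥ z := by simpa using hQ.dotProduct_mulVec_pos hz0
    refine ⟨(z ⬝ᵥ Q *ᵥ z)⁻¹, inv_pos.mpr hm, fun x => ?_⟩
    by_cases hx : x = 0
    · simp [hx]
    have hx' : 0 < ‖x‖ := norm_pos_iff.mpr hx
    have hs : (‖x‖⁻¹ • x) ∈ Metric.sphere (0 : Fin d → ℝ) 1 := by
      simp [norm_smul, hx'.ne']
    have h1 := hmin hs
    simp only [Set.mem_ofPred_eq, Matrix.mulVec_smul, dotProduct_smul, smul_dotProduct,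
      smul_eq_mul] at h1
    rw [le_inv_mul_iff₀ hm]
    have h2 := mul_le_mul_of_nonneg_left h1 (sq_nonneg ‖x‖)
    calc _ = ‖x‖ ^ 2 * (z ⬝ᵥ Q *ᵥ z) := by ring
      _ ≤ _ := h2
      _ = _ := by field_simp

/-- bilinear form of a complex matrix at real vectors. -/
noncomputable def bil {d : ℕ} (V : Matrix (Fin d) (Fin d) ℂ) (x y : Fin d → ℝ) : ℂ :=
  (fun a => (x a : ℂ)) ⬝ᵥ V *ᵥ (fun a => (y a : ℂ))

lemma bil_bound {d : ℕ} (V : Matrix (Fin d) (Fin d) ℂ) :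
    ∃ c : ℝ, 0 ≤ c ∧ ∀ x y : Fin d → ℝ, ‖bil V x y‖ ≤ c * (‖x‖ ^ 2 + ‖y‖ ^ 2) := by
  refine ⟨∑ a, ∑ b, ‖V a b‖, by positivity, fun x y => ?_⟩
  simp only [bil, dotProduct, Matrix.mulVec, Finset.mul_sum, Finset.sum_mul]
  refine (norm_sum_le _ _).trans (Finset.sum_le_sum fun a _ => ?_)
  refine (norm_sum_le _ _).trans (Finset.sum_le_sum fun b _ => ?_)
  rw [norm_mul, norm_mul, Complex.norm_real, Complex.norm_real]
  have h1 := norm_le_pi_norm x a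
  have h2 := norm_le_pi_norm y b
  have h3 : ‖x a‖ * ‖y b‖ ≤ ‖x‖ * ‖y‖ := by gcongr
  have h4 : ‖x a‖ * ‖y b‖ ≤ ‖x‖ ^ 2 + ‖y‖ ^ 2 := by
    nlinarith [sq_nonneg (‖x‖ - ‖y‖), sq_nonneg ‖x‖, sq_nonneg ‖y‖]
  calc _ = ‖V a b‖ * (‖x a‖ * ‖y b‖) := by ring
    _ ≤ _ := by gcongr

lemma bil_congr {d : ℕ} (V : Matrix (Fin d) (Fin d) ℂ) (Γ : Matrix (Fin d) (Fin d) ℝ)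
    (x y : Fin d → ℝ) :
    bil ((Γ.map (algebraMap ℝ ℂ))ᵀ * V * Γ.map (algebraMap ℝ ℂ)) x y
      = bil V (Γ *ᵥ x) (Γ *ᵥ y) := by
  have h : ∀ x : Fin d → ℝ, (fun a => (((Γ *ᵥ x) a : ℝ) : ℂ)) =
      Γ.map (algebraMap ℝ ℂ) *ᵥ (fun a => (x a : ℂ)) := by
    intro x
    ext a
    simp [Matrix.mulVec, dotProduct]
  unfold bil
  rw [h, h, ← Matrix.mulVec_mulVec, ← Matrix.mulVec_mulVec, Matrix.dotProduct_mulVec,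
    Matrix.vecMul_transpose]

lemma bil_sum {d N : ℕ} (V : Fin N → Matrix (Fin d) (Fin d) ℂ) (p : Fin N → ℝ)
    (x y : Fin d → ℝ) :
    bil (∑ j, (algebraMap ℝ ℂ (p j)) • V j) x y = ∑ j, (p j : ℂ) * bil (V j) x y := by
  simp [bil, Matrix.sum_mulVec, dotProduct_sum, Matrix.smul_mulVec]

lemma quad_sum {d N : ℕ} (V : Fin N → Matrix (Fin d) (Fin d) ℝ) (p : Fin N → ℝ)
    (x : Fin d → ℝ) :
    x ⬝ᵥ (∑ j, p j • V j) *ᵥ x = ∑ j, p j * (x ⬝ᵥ V j *ᵥ x) := by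
  simp [Matrix.sum_mulVec, dotProduct_sum, Matrix.smul_mulVec]

lemma quad_congr {d k : ℕ} (V : Matrix (Fin k) (Fin k) ℝ) (Γ : Matrix (Fin k) (Fin d) ℝ)
    (x : Fin d → ℝ) :
    x ⬝ᵥ (Γᵀ * V * Γ) *ᵥ x = (Γ *ᵥ x) ⬝ᵥ V *ᵥ (Γ *ᵥ x) := by
  rw [← Matrix.mulVec_mulVec, ← Matrix.mulVec_mulVec, Matrix.dotProduct_mulVec,
    Matrix.vecMul_transpose]

lemma quad_bound {d : ℕ} (V : Matrix (Fin d) (Fin d) ℝ) :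
    ∃ c : ℝ, 0 ≤ c ∧ ∀ x : Fin d → ℝ, x ⬝ᵥ V *ᵥ x ≤ c * ‖x‖ ^ 2 := by
  obtain ⟨c, hc, h⟩ := bil_bound (V.map (algebraMap ℝ ℂ))
  refine ⟨2 * c, by positivity, fun x => ?_⟩
  have h1 := h x x
  have h2 : bil (V.map (algebraMap ℝ ℂ)) x x = ((x ⬝ᵥ V *ᵥ x : ℝ) : ℂ) := by
    simp [bil, dotProduct, Matrix.mulVec]
  rw [h2, Complex.norm_real] at h1
  have := le_abs_self (x ⬝ᵥ V *ᵥ x)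
  rw [Real.norm_eq_abs] at h1
  linarith

/-- Lyapunov criterion. -/
lemma lyap_stable {d N : ℕ} (hd : 0 < d) (hN : 0 < N) (Pr : Matrix (Fin N) (Fin N) ℝ)
    (hPr : ∀ i j, 0 ≤ Pr i j) (Γ P Q : Fin N → Matrix (Fin d) (Fin d) ℝ)
    (hQ : ∀ i, (Q i).PosDef) (hP : ∀ i, (P i).PosSemidef)
    (h : ∀ i, (P i - (Γ i)ᵀ * opE Pr P i * Γ i - Q i).PosSemidef) :
    spectralRadius ℂ ((calA Pr Γ).map (algebraMap ℝ ℂ)) < 1 := by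
  classical
  haveI : Nonempty (Fin d) := ⟨⟨0, hd⟩⟩
  haveI : Nonempty (Fin N) := ⟨⟨0, hN⟩⟩
  letI : NormedRing (Matrix (Fin N × Fin d × Fin d) (Fin N × Fin d × Fin d) ℂ) :=
    Matrix.linftyOpNormedRing
  letI : NormedAlgebra ℂ (Matrix (Fin N × Fin d × Fin d) (Fin N × Fin d × Fin d) ℂ) :=
    Matrix.linftyOpNormedAlgebra
  obtain ⟨l, hl, hlr⟩ := spectrum.exists_nnnorm_eq_spectralRadius
    ((calA Pr Γ).map (algebraMap ℝ ℂ))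
  rw [← hlr]
  by_contra hcon
  have hl1 : 1 ≤ ‖l‖ := by
    have : (1 : ENNReal) ≤ (‖l‖₊ : ENNReal) := not_lt.mp hcon
    exact_mod_cast this
  -- eigenvector
  rw [← Matrix.spectrum_toLin', ← Module.End.hasEigenvalue_iff_mem_spectrum] at hl
  obtain ⟨v, hv⟩ := hl.exists_hasEigenvector
  have hv1 := hv.apply_eq_smul
  have hv0 := hv.2
  rw [Matrix.toLin'_apply] at hv1
  set V : Fin N → Matrix (Fin d) (Fin d) ℂ := fun i => Matrix.of fun a b => v (i, a, b) with hV
  have hVeq : ∀ i, l • V i = ((Γ i).map (algebraMap ℝ ℂ))ᵀ *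
      (∑ j, (algebraMap ℝ ℂ (Pr i j)) • V j) * (Γ i).map (algebraMap ℝ ℂ) := by
    intro i
    ext a b
    rw [← calA_mulVec (algebraMap ℝ ℂ) Pr Γ v i a b, hv1]
    simp [hV]
  have hbil : ∀ i x y, l * bil (V i) x y =
      ∑ j, (Pr i j : ℂ) * bil (V j) (Γ i *ᵥ x) (Γ i *ᵥ y) := by
    intro i x y
    rw [← bil_sum, ← bil_congr, ← hVeq]
    simp [bil, Matrix.smul_mulVec]
  -- bounds
  choose cQ hcQ hcQb using fun i => posDef_norm_bound (Q i) (hQ i)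
  choose cP hcP hcPb using fun i => quad_bound (P i)
  choose cV hcV hcVb using fun i => bil_bound (V i)
  have hquad : ∀ i x, x ⬝ᵥ Q i *ᵥ x + ∑ j, Pr i j * ((Γ i *ᵥ x) ⬝ᵥ P j *ᵥ (Γ i *ᵥ x))
      ≤ x ⬝ᵥ P i *ᵥ x := by
    intro i x
    have := (h i).dotProduct_mulVec_nonneg x
    simp only [star_trivial, Matrix.sub_mulVec, dotProduct_sub] at this
    rw [quad_congr, opE, quad_sum] at this
    linarith
  have hPnn : ∀ i x, 0 ≤ x ⬝ᵥ P i *ᵥ x := fun i x => by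
    simpa using (hP i).dotProduct_mulVec_nonneg x
  have hQnn : ∀ i x, 0 ≤ x ⬝ᵥ Q i *ᵥ x := fun i x => by
    simpa using (hQ i).posSemidef.dotProduct_mulVec_nonneg x
  have hQP : ∀ i x, x ⬝ᵥ Q i *ᵥ x ≤ x ⬝ᵥ P i *ᵥ x := by
    intro i x
    have h1 := hquad i x
    have h2 : 0 ≤ ∑ j, Pr i j * ((Γ i *ᵥ x) ⬝ᵥ P j *ᵥ (Γ i *ᵥ x)) :=
      Finset.sum_nonneg fun j _ => mul_nonneg (hPr i j) (hPnn j _)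
    linarith
  -- contraction factor
  set M : ℝ := 1 + ∑ i, cP i * cQ i with hM
  have hMi : ∀ i, cP i * cQ i ≤ M := by
    intro i
    have := Finset.single_le_sum (f := fun i => cP i * cQ i)
      (fun i _ => mul_nonneg (hcP i) (hcQ i).le) (Finset.mem_univ i)
    linarith
  have hM1 : 1 ≤ M := by
    have : 0 ≤ ∑ i, cP i * cQ i := Finset.sum_nonneg fun i _ => mul_nonneg (hcP i) (hcQ i).le
    linarith
  have hMpos : 0 < M := by linarith
  have hPQ : ∀ i x, x ⬝ᵥ P i *ᵥ x ≤ M * (x ⬝ᵥ Q i *ᵥ x) := by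
    intro i x
    calc x ⬝ᵥ P i *ᵥ x ≤ cP i * ‖x‖ ^ 2 := hcPb i x
      _ ≤ cP i * (cQ i * (x ⬝ᵥ Q i *ᵥ x)) := mul_le_mul_of_nonneg_left (hcQb i x) (hcP i)
      _ = (cP i * cQ i) * (x ⬝ᵥ Q i *ᵥ x) := by ring
      _ ≤ _ := mul_le_mul_of_nonneg_right (hMi i) (hQnn i x)
  set r : ℝ := 1 - M⁻¹ with hr
  have hr0 : 0 ≤ r := by
    have : M⁻¹ ≤ 1 := inv_le_one_of_one_le₀ hM1
    linarith
  have hr1 : r < 1 := by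
    have : 0 < M⁻¹ := inv_pos.mpr hMpos
    linarith
  have hcontr : ∀ i x, ∑ j, Pr i j * ((Γ i *ᵥ x) ⬝ᵥ P j *ᵥ (Γ i *ᵥ x))
      ≤ r * (x ⬝ᵥ P i *ᵥ x) := by
    intro i x
    have h1 := hquad i x
    have h2 : M⁻¹ * (x ⬝ᵥ P i *ᵥ x) ≤ x ⬝ᵥ Q i *ᵥ x := by
      rw [inv_mul_le_iff₀ hMpos]; exact hPQ i x
    rw [hr, sub_mul]
    linarith
  set C : ℝ := ∑ i, cV i * cQ i with hC
  have hCi : ∀ i, cV i * cQ i ≤ C := fun i =>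
    Finset.single_le_sum (f := fun i => cV i * cQ i)
      (fun i _ => mul_nonneg (hcV i) (hcQ i).le) (Finset.mem_univ i)
  have key : ∀ n : ℕ, ∀ i x y, ‖bil (V i) x y‖ ≤
      C * r ^ n * (x ⬝ᵥ P i *ᵥ x + y ⬝ᵥ P i *ᵥ y) := by
    intro n
    induction n with
    | zero =>
      intro i x y
      calc ‖bil (V i) x y‖ ≤ cV i * (‖x‖ ^ 2 + ‖y‖ ^ 2) := hcVb i x y
        _ ≤ cV i * (cQ i * (x ⬝ᵥ P i *ᵥ x) + cQ i * (y ⬝ᵥ P i *ᵥ y)) := by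
          refine mul_le_mul_of_nonneg_left (add_le_add ?_ ?_) (hcV i)
          · exact (hcQb i x).trans (mul_le_mul_of_nonneg_left (hQP i x) (hcQ i).le)
          · exact (hcQb i y).trans (mul_le_mul_of_nonneg_left (hQP i y) (hcQ i).le)
        _ = (cV i * cQ i) * (x ⬝ᵥ P i *ᵥ x + y ⬝ᵥ P i *ᵥ y) := by ring
        _ ≤ C * (x ⬝ᵥ P i *ᵥ x + y ⬝ᵥ P i *ᵥ y) :=
          mul_le_mul_of_nonneg_right (hCi i) (add_nonneg (hPnn i x) (hPnn i y))
        _ = _ := by ring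
    | succ n ih =>
      intro i x y
      have hC0 : 0 ≤ C := Finset.sum_nonneg fun i _ => mul_nonneg (hcV i) (hcQ i).le
      calc ‖bil (V i) x y‖ ≤ ‖l‖ * ‖bil (V i) x y‖ := le_mul_of_one_le_left (norm_nonneg _) hl1
        _ = ‖∑ j, (Pr i j : ℂ) * bil (V j) (Γ i *ᵥ x) (Γ i *ᵥ y)‖ := by
          rw [← norm_mul, hbil]
        _ ≤ ∑ j, Pr i j * (C * r ^ n * ((Γ i *ᵥ x) ⬝ᵥ P j *ᵥ (Γ i *ᵥ x) +
              (Γ i *ᵥ y) ⬝ᵥ P j *ᵥ (Γ i *ᵥ y))) := by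
          refine (norm_sum_le _ _).trans (Finset.sum_le_sum fun j _ => ?_)
          rw [norm_mul, Complex.norm_real, Real.norm_of_nonneg (hPr i j)]
          exact mul_le_mul_of_nonneg_left (ih j _ _) (hPr i j)
        _ = C * r ^ n * (∑ j, Pr i j * ((Γ i *ᵥ x) ⬝ᵥ P j *ᵥ (Γ i *ᵥ x)) +
              ∑ j, Pr i j * ((Γ i *ᵥ y) ⬝ᵥ P j *ᵥ (Γ i *ᵥ y))) := by
          rw [← Finset.sum_add_distrib, Finset.mul_sum]
          exact Finset.sum_congr rfl fun j _ => by ring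
        _ ≤ C * r ^ n * (r * (x ⬝ᵥ P i *ᵥ x) + r * (y ⬝ᵥ P i *ᵥ y)) :=
          mul_le_mul_of_nonneg_left (add_le_add (hcontr i x) (hcontr i y)) (by positivity)
        _ = _ := by ring
  apply hv0
  ext ⟨i, a, b⟩
  have hz : bil (V i) (Pi.single a 1) (Pi.single b 1) = v (i, a, b) := by
    have hs : ∀ a : Fin d, (fun c => (((Pi.single a 1 : Fin d → ℝ) c : ℝ) : ℂ)) =
        Pi.single a 1 := by
      intro a
      ext c
      by_cases hc : c = a
      · subst hc; simp
      · simp [hc]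
    simp [bil, hs, hV]
  rw [← hz]
  have hlim : Tendsto (fun n : ℕ => C * r ^ n * ((Pi.single a 1 : Fin d → ℝ) ⬝ᵥ P i *ᵥ
      (Pi.single a 1) + (Pi.single b 1 : Fin d → ℝ) ⬝ᵥ P i *ᵥ (Pi.single b 1))) atTop (𝓝 0) := by
    have := ((tendsto_pow_atTop_nhds_zero_of_lt_one hr0 hr1).const_mul C).mul_const
      ((Pi.single a 1 : Fin d → ℝ) ⬝ᵥ P i *ᵥ
      (Pi.single a 1) + (Pi.single b 1 : Fin d → ℝ) ⬝ᵥ P i *ᵥ (Pi.single b 1))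
    simpa using this
  have := ge_of_tendsto' hlim fun n => key n i (Pi.single a 1) (Pi.single b 1)
  simpa using norm_le_zero_iff.mp this

lemma pow_tendsto_zero {n : Type*} [Fintype n] [DecidableEq n] [Nonempty n] (M : Matrix n n ℝ)
    (h : spectralRadius ℂ (M.map (algebraMap ℝ ℂ)) < 1) :
    ∀ a b, Tendsto (fun t : ℕ => (M ^ t) a b) atTop (𝓝 0) := by
  letI : NormedRing (Matrix n n ℂ) := Matrix.linftyOpNormedRing
  letI : NormedAlgebra ℂ (Matrix n n ℂ) := Matrix.linftyOpNormedAlgebra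
  have hg := spectrum.pow_nnnorm_pow_one_div_tendsto_nhds_spectralRadius
    (M.map (algebraMap ℝ ℂ))
  obtain ⟨r, hr1, hr2⟩ := ENNReal.lt_iff_exists_nnreal_btwn.mp h
  have hev := (hg.eventually (gt_mem_nhds hr1)).and (eventually_gt_atTop 0)
  intro a b
  have hr2' : (r : ℝ) < 1 := by exact_mod_cast hr2
  refine squeeze_zero_norm' (a := fun t : ℕ => (r : ℝ) ^ t) ?_
    (tendsto_pow_atTop_nhds_zero_of_lt_one r.2 hr2')
  filter_upwards [hev] with t ht
  obtain ⟨ht1, ht0⟩ := ht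
  have h1 : ‖(M.map (algebraMap ℝ ℂ)) ^ t‖₊ ≤ r ^ t := by
    have h2 := ENNReal.rpow_le_rpow ht1.le (z := (t : ℝ)) (by positivity)
    rw [← ENNReal.rpow_mul, one_div, inv_mul_cancel₀ (by positivity), ENNReal.rpow_one,
      ENNReal.rpow_natCast] at h2
    exact_mod_cast h2
  have h3 : (M.map (algebraMap ℝ ℂ)) ^ t = (M ^ t).map (algebraMap ℝ ℂ) := by
    rw [← RingHom.mapMatrix_apply, ← RingHom.mapMatrix_apply, map_pow]
  have h4 : ‖((M ^ t).map (algebraMap ℝ ℂ)) a b‖₊ ≤ ‖(M ^ t).map (algebraMap ℝ ℂ)‖₊ := by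
    rw [Matrix.linfty_opNNNorm_def]
    refine le_trans ?_ (Finset.le_sup (f := fun i => ∑ j, ‖((M ^ t).map (algebraMap ℝ ℂ)) i j‖₊)
      (Finset.mem_univ a))
    exact Finset.single_le_sum (f := fun j => ‖((M ^ t).map (algebraMap ℝ ℂ)) a j‖₊)
      (fun _ _ => zero_le) (Finset.mem_univ b)
  rw [← h3] at h4
  have h5 := h4.trans h1
  rw [h3] at h5
  have h6 : ‖((M ^ t).map (algebraMap ℝ ℂ)) a b‖ ≤ (r : ℝ) ^ t := by exact_mod_cast h5
  simpa using h6

lemma posSemidef_congr' {a b : ℕ} {E : Matrix (Fin a) (Fin a) ℝ} (hE : E.PosSemidef)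
    (G : Matrix (Fin a) (Fin b) ℝ) : (Gᵀ * E * G).PosSemidef := by
  simpa [Matrix.conjTranspose_eq_transpose_of_trivial] using hE.conjTranspose_mul_mul_same G

lemma posSemidef_opE {d N : ℕ} {Pr : Matrix (Fin N) (Fin N) ℝ}
    (hPr : ∀ i j, 0 ≤ Pr i j) {P : Fin N → Matrix (Fin d) (Fin d) ℝ}
    (hP : ∀ i, (P i).PosSemidef) (i : Fin N) : (opE Pr P i).PosSemidef :=
  Matrix.posSemidef_sum _ fun j _ => (hP j).smul (hPr i j)

lemma calA_mulVec_real {d N : ℕ}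
    (Pr : Matrix (Fin N) (Fin N) ℝ)
    (Γ : Fin N → Matrix (Fin d) (Fin d) ℝ) (v : Fin N × Fin d × Fin d → ℝ)
    (i : Fin N) :
    (Matrix.of fun a b => (calA Pr Γ *ᵥ v) (i, a, b)) =
      (Γ i)ᵀ * opE Pr (fun j => Matrix.of fun c e => v (j, c, e)) i * Γ i := by
  ext a b
  have := calA_mulVec (RingHom.id ℝ) Pr Γ v i a b
  simpa [opE] using this

lemma lyap_posSemidef {d N : ℕ} (hd : 0 < d) (hN : 0 < N) (Pr : Matrix (Fin N) (Fin N) ℝ)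
    (hPr : ∀ i j, 0 ≤ Pr i j) (Γ P W : Fin N → Matrix (Fin d) (Fin d) ℝ)
    (hs : spectralRadius ℂ ((calA Pr Γ).map (algebraMap ℝ ℂ)) < 1)
    (hW : ∀ i, (W i).PosSemidef)
    (h : ∀ i, P i = W i + (Γ i)ᵀ * opE Pr P i * Γ i) : ∀ i, (P i).PosSemidef := by
  classical
  haveI : Nonempty (Fin d) := ⟨⟨0, hd⟩⟩
  haveI : Nonempty (Fin N) := ⟨⟨0, hN⟩⟩
  set p : Fin N × Fin d × Fin d → ℝ := fun z => P z.1 z.2.1 z.2.2 with hp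
  set q : Fin N × Fin d × Fin d → ℝ := fun z => W z.1 z.2.1 z.2.2 with hq
  set T := calA Pr Γ with hT
  have hfix : p = q + T *ᵥ p := by
    ext ⟨i, a, b⟩
    have h1 := calA_mulVec_real Pr Γ p i
    have h2 := congrFun (congrFun (h i) a) b
    have h3 := congrFun (congrFun h1 a) b
    simp only [Matrix.of_apply] at h3
    rw [Pi.add_apply, hT, h3]
    exact h2
  set F : ℕ → Fin N → Matrix (Fin d) (Fin d) ℝ := fun n i =>
    Matrix.of fun a b => (p - (T ^ n) *ᵥ p) (i, a, b) with hF
  have hFpsd : ∀ n i, (F n i).PosSemidef := by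
    intro n
    induction n with
    | zero =>
      intro i
      have : F 0 i = 0 := by ext a b; simp [hF]
      rw [this]; exact Matrix.PosSemidef.zero
    | succ n ih =>
      intro i
      have : F (n + 1) i = W i + (Γ i)ᵀ * opE Pr (F n) i * Γ i := by
        rw [hF, ← calA_mulVec_real Pr Γ (p - (T ^ n) *ᵥ p) i]
        ext a b
        simp only [Matrix.of_apply, Matrix.add_apply]
        have e : p - T ^ (n + 1) *ᵥ p = q + T *ᵥ (p - T ^ n *ᵥ p) := by
          rw [Matrix.mulVec_sub, Matrix.mulVec_mulVec, ← pow_succ', ← add_sub_assoc, ← hfix]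
        rw [e, Pi.add_apply]
      rw [this]
      exact (hW i).add (posSemidef_congr' (posSemidef_opE hPr ih i) _)
  intro i
  have hlim : Tendsto (fun n => F n i) atTop (𝓝 (P i)) := by
    refine tendsto_pi_nhds.mpr fun a => tendsto_pi_nhds.mpr fun b => ?_
    have h0 : Tendsto (fun n => ((T ^ n) *ᵥ p) (i, a, b)) atTop (𝓝 0) := by
      have := tendsto_finsetSum Finset.univ fun z _ =>
        (pow_tendsto_zero T hs (i, a, b) z).mul_const (p z)
      simpa [Matrix.mulVec, dotProduct] using this
    have := h0.const_sub (p (i, a, b))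
    simpa [hF, hp] using this
  refine Matrix.PosSemidef.of_dotProduct_mulVec_nonneg ?_ fun x => ?_
  · have h2 : Tendsto (fun n => (F n i)ᴴ) atTop (𝓝 (P i)ᴴ) :=
      ((continuous_id.matrix_conjTranspose).tendsto _).comp hlim
    have h3 : (fun n => (F n i)ᴴ) = fun n => F n i := funext fun n => (hFpsd n i).1
    rw [h3] at h2
    exact tendsto_nhds_unique h2 hlim
  · have hc : Continuous fun M : Matrix (Fin d) (Fin d) ℝ => star x ⬝ᵥ M *ᵥ x := by fun_prop
    exact ge_of_tendsto' ((hc.tendsto _).comp hlim)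
      fun n => (hFpsd n i).dotProduct_mulVec_nonneg x

lemma lyap_exists {d N : ℕ} (Pr : Matrix (Fin N) (Fin N) ℝ)
    (Γ W : Fin N → Matrix (Fin d) (Fin d) ℝ)
    (hs : spectralRadius ℂ ((calA Pr Γ).map (algebraMap ℝ ℂ)) < 1) :
    ∃ P : Fin N → Matrix (Fin d) (Fin d) ℝ,
      ∀ i, P i = W i + (Γ i)ᵀ * opE Pr P i * Γ i := by
  classical
  set T := calA Pr Γ with hT
  have h1 : (1 : ℂ) ∈ resolventSet ℂ (T.map (algebraMap ℝ ℂ)) :=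
    spectrum.mem_resolventSet_of_spectralRadius_lt (by simpa using hs)
  rw [spectrum.mem_resolventSet_iff, map_one, Matrix.isUnit_iff_isUnit_det] at h1
  have h2 : (1 - T.map (algebraMap ℝ ℂ)) = (1 - T).map (algebraMap ℝ ℂ) := by
    simp only [← RingHom.mapMatrix_apply, map_sub, map_one]
  rw [h2, ← RingHom.mapMatrix_apply, ← RingHom.map_det] at h1
  have h3 : IsUnit (1 - T).det := by
    rw [isUnit_iff_ne_zero] at h1 ⊢
    intro h; apply h1; rw [h]; simp
  set q : Fin N × Fin d × Fin d → ℝ := fun z => W z.1 z.2.1 z.2.2 with hq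
  set p := (1 - T)⁻¹ *ᵥ q with hp
  have h4 : p = q + T *ᵥ p := by
    have : (1 - T) *ᵥ p = q := by
      rw [hp, Matrix.mulVec_mulVec, Matrix.mul_nonsing_inv _ h3, Matrix.one_mulVec]
    rw [Matrix.sub_mulVec, Matrix.one_mulVec] at this
    rw [← this]; simp
  refine ⟨fun i => Matrix.of fun a b => p (i, a, b), fun i => ?_⟩
  rw [← calA_mulVec_real]
  ext a b
  have := congrFun h4 (i, a, b)
  simpa [hq] using this

lemma gn_identity {d k : ℕ} (A E P Q : Matrix (Fin d) (Fin d) ℝ) (B : Matrix (Fin d) (Fin k) ℝ)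
    (R : Matrix (Fin k) (Fin k) ℝ) (K G : Matrix (Fin k) (Fin d) ℝ) (t : ℝ)
    (hE : Eᵀ = E) (hR : Rᵀ = R)
    (hP : P = Q + Kᵀ * R * K + (A - B * K)ᵀ * E * (A - B * K))
    (hG : (R + Bᵀ * E * B) * G = (R + Bᵀ * E * B) * K - Bᵀ * E * A) :
    P - (A - B * (K - t • G))ᵀ * E * (A - B * (K - t • G)) - Q =
      (K - t • G)ᵀ * R * (K - t • G) + (t * (2 - t)) • (Gᵀ * (R + Bᵀ * E * B) * G) := by
  have h1 : Bᵀ * (E * A) = R * K + Bᵀ * (E * (B * K)) - R * G - Bᵀ * (E * (B * G)) := by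
    simp only [Matrix.add_mul, Matrix.mul_assoc] at hG
    rw [sub_sub, hG]; abel
  have h2 : Aᵀ * (E * B) = Kᵀ * R + Kᵀ * (Bᵀ * (E * B)) - Gᵀ * R - Gᵀ * (Bᵀ * (E * B)) := by
    have := congrArg Matrix.transpose h1
    simpa [Matrix.transpose_mul, hE, hR, Matrix.mul_assoc] using this
  have h2' : ∀ X : Matrix (Fin k) (Fin d) ℝ, Aᵀ * (E * (B * X)) =
      Kᵀ * (R * X) + Kᵀ * (Bᵀ * (E * (B * X))) - Gᵀ * (R * X) - Gᵀ * (Bᵀ * (E * (B * X))) := by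
    intro X
    have := congrArg (fun M => M * X) h2
    simpa [Matrix.add_mul, Matrix.sub_mul, Matrix.mul_assoc] using this
  rw [hP]
  simp only [Matrix.transpose_sub, Matrix.transpose_mul, Matrix.transpose_smul, Matrix.mul_assoc,
    Matrix.mul_sub, Matrix.sub_mul, Matrix.mul_add, Matrix.add_mul, Matrix.mul_smul,
    Matrix.smul_mul, h1, h2', smul_sub, smul_add]
  module

/-- feasibility of the Gauss-Newton step. -/
theorem gauss_newton_step_feasibility
    (d k N : ℕ) (hd : 0 < d) (hk : 0 < k) (hN : 0 < N)
    (A : Fin N → Matrix (Fin d) (Fin d) ℝ) (B : Fin N → Matrix (Fin d) (Fin k) ℝ)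
    (Pr : Matrix (Fin N) (Fin N) ℝ)
    (hPr : ∀ i j, 0 ≤ Pr i j) (hPrSum : ∀ i, ∑ j, Pr i j = 1)
    (piv : Fin N → ℝ) (hpiv : ∀ i, 0 < piv i) (hpivSum : ∑ i, piv i = 1)
    (Sg : Matrix (Fin d) (Fin d) ℝ) (hSg : Sg.PosDef)
    (Q : Fin N → Matrix (Fin d) (Fin d) ℝ) (hQ : ∀ i, (Q i).PosDef)
    (R : Fin N → Matrix (Fin k) (Fin k) ℝ) (hR : ∀ i, (R i).PosDef)
    (K : Fin N → Matrix (Fin k) (Fin d) ℝ) (hK : MSS Pr A B K)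
    (η : ℝ) (hη0 : 0 < η) (hη : η ≤ 1 / 2) :
    MSS Pr A B (fun i => K i - (2 * η) • ((R i + (B i)ᵀ * opE Pr (PK Pr A B Q R K) i * B i)⁻¹ * LK Pr A B Q R K i)) := by
  have hex : ∃ P, IsLyap Pr A B Q R K P :=
    lyap_exists Pr (Gam A B K) (fun i => Q i + (K i)ᵀ * R i * K i) hK
  have hPK : IsLyap Pr A B Q R K (PK Pr A B Q R K) := by
    unfold PK
    rw [dif_pos hex]
    exact hex.choose_spec
  have hPsd : ∀ i, (PK Pr A B Q R K i).PosSemidef :=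
    lyap_posSemidef hd hN Pr hPr (Gam A B K) _ (fun i => Q i + (K i)ᵀ * R i * K i) hK
      (fun i => (hQ i).posSemidef.add (posSemidef_congr' (hR i).posSemidef _)) hPK
  unfold MSS
  refine lyap_stable hd hN Pr hPr _ (PK Pr A B Q R K) Q hQ hPsd fun i => ?_
  have hE := posSemidef_opE hPr hPsd i
  have hS : (R i + (B i)ᵀ * opE Pr (PK Pr A B Q R K) i * B i).PosDef :=
    (hR i).add_posSemidef (posSemidef_congr' hE _)
  have hG : (R i + (B i)ᵀ * opE Pr (PK Pr A B Q R K) i * B i) *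
      ((R i + (B i)ᵀ * opE Pr (PK Pr A B Q R K) i * B i)⁻¹ * LK Pr A B Q R K i) =
      (R i + (B i)ᵀ * opE Pr (PK Pr A B Q R K) i * B i) * K i -
        (B i)ᵀ * opE Pr (PK Pr A B Q R K) i * A i := by
    rw [← Matrix.mul_assoc, Matrix.mul_nonsing_inv _
      ((Matrix.isUnit_iff_isUnit_det _).mp hS.isUnit), Matrix.one_mul]
    rfl
  have hEt : (opE Pr (PK Pr A B Q R K) i)ᵀ = opE Pr (PK Pr A B Q R K) i := by
    simpa [Matrix.IsHermitian, Matrix.conjTranspose_eq_transpose_of_trivial] using hE.1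
  have hRt : (R i)ᵀ = R i := by
    simpa [Matrix.IsHermitian, Matrix.conjTranspose_eq_transpose_of_trivial] using (hR i).1
  have hid := gn_identity (A i) (opE Pr (PK Pr A B Q R K) i) (PK Pr A B Q R K i) (Q i) (B i) (R i)
    (K i) _ (2 * η) hEt hRt (hPK i) hG
  simp only [Gam]
  rw [hid]
  refine (posSemidef_congr' (hR i).posSemidef _).add
    ((posSemidef_congr' hS.posSemidef _).smul ?_)
  nlinarith

end MJLS
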